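/- arXiv:1708.00203 — 3 statements merged into one kernel-verified Lean document; each statement's English description precedes it below -/
import Mathlib

section
/- Let Λ be a k-algebra, S a finite set, and {e_x}_{x∈S} a complete set of orthogonal idempotents of Λ (e_x e_y = 0 for x ≠ y, e_x² = e_x, and Σ_{x∈S} e_x = 1). Let D ⊆ Λ be the k-subalgebra spanned by the e_x (so D ≅ k^S is commutative and separable), and let Z be a Λ-bimodule. Form the cochain complex J•(Z) with J⁰ = Z^D := {z ∈ Z : e_x z = z e_x for all x ∈ S} and, for n ≥ 1, Jⁿ = Hom_{D-D}(Λ^{⊗_D n}, Z), the D-bimodule maps from the n-fold tensor product of Λ over D (each tensor taken of the right D-module structure of one factor with the left D-module structure of the next), with differential (df)(x₁⊗⋯⊗x_{n+1}) = x₁·f(x₂⊗⋯⊗x_{n+1}) + Σ_{i=1}^{n} (−1)^i f(x₁⊗⋯⊗x_i x_{i+1}⊗⋯⊗x_{n+1}) + (−1)^{n+1} f(x₁⊗⋯⊗x_n)·x_{n+1}, and (dz)(x) = x·z − z·x for z ∈ Z^D. Then for every n ≥ 0 the n-th cohomology of J•(Z) is isomorphic as a k-vector space to HH^n(Λ, Z)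 = Ext^n_{Λ^e}(Λ, Z). -/
open scoped TensorProduct
open CategoryTheory MulOpposite

noncomputable section

/-- Merging two adjacent entries of a tuple by multiplication:
`(x₁, …, x_{n+1}) ↦ (x₁, …, xⱼ·x_{j+1}, …, x_{n+1})`. -/
def merge {X : Type} [Mul X] {n : ℕ} (v : Fin (n + 1) → X) (j : Fin n) : Fin n → X :=
  fun l => if (l : ℕ) < (j : ℕ) then v l.castSucc
    else if (l : ℕ) = (j : ℕ) then v l.castSucc * v l.succ else v l.succ

section

variable (k : Type) [Field k] (L : Type) [Ring L] [Algebra k L]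
  (Z : Type) [AddCommGroup Z] [Module k Z] [Module L Z] [Module Lᵐᵒᵖ Z]
  [SMulCommClass L Lᵐᵒᵖ Z] [IsScalarTower k L Z] [IsScalarTower k Lᵐᵒᵖ Z]

/-- `L` is a module over its enveloping algebra `L ⊗[k] Lᵐᵒᵖ`. -/
instance envModule : Module (L ⊗[k] Lᵐᵒᵖ) L := TensorProduct.Algebra.module

/-- The `L`-bimodule `Z` as a left module over the enveloping algebra `L ⊗[k] Lᵐᵒᵖ`. -/
instance envModuleZ : Module (L ⊗[k] Lᵐᵒᵖ) Z := TensorProduct.Algebra.module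

instance : SMulCommClass k L Z := IsScalarTower.to_smulCommClass
instance : SMulCommClass L k Z := SMulCommClass.symm _ _ _
instance : SMulCommClass k Lᵐᵒᵖ Z := IsScalarTower.to_smulCommClass
instance : SMulCommClass Lᵐᵒᵖ k Z := SMulCommClass.symm _ _ _

/-- Hochschild cohomology `HH^n(L, Z) = Ext^n_{L ⊗[k] Lᵐᵒᵖ}(L, Z)` of `L` with
coefficients in the bimodule `Z`, computed in the abelian category of left modules over
the enveloping algebra. -/
def HHZ (n : ℕ) : ModuleCat k :=
  ((Ext k (ModuleCat (L ⊗[k] Lᵐᵒᵖ)) n).obj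
    (Opposite.op (ModuleCat.of (L ⊗[k] Lᵐᵒᵖ) L))).obj (ModuleCat.of (L ⊗[k] Lᵐᵒᵖ) Z)

/-- Raw `n`-cochains: functions `Λⁿ → Z`. -/
abbrev Raw (n : ℕ) : Type := (Fin n → L) → Z

section builders

variable {n : ℕ}

/-- `f ↦ (x₁,…,x_{n+1}) ↦ x₁ · f(x₂,…,x_{n+1})`. -/
def tL : Raw L Z n →ₗ[k] Raw L Z (n + 1) where
  toFun f := fun v => v 0 • f (Fin.tail v)
  map_add' f f' := by funext v; exact smul_add _ _ _
  map_smul' c f := by funext v; exact smul_comm _ _ _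

/-- `f ↦ (x₁,…,x_{n+1}) ↦ f(x₁,…,xⱼx_{j+1},…,x_{n+1})`. -/
def mL (j : Fin n) : Raw L Z n →ₗ[k] Raw L Z (n + 1) where
  toFun f := fun v => f (merge v j)
  map_add' f f' := rfl
  map_smul' c f := rfl

/-- `f ↦ (x₁,…,x_{n+1}) ↦ f(x₁,…,x_n) · x_{n+1}`. -/
def lL : Raw L Z n →ₗ[k] Raw L Z (n + 1) where
  toFun f := fun v => op (v (Fin.last n)) • f (Fin.init v)
  map_add' f f' := by funext v; exact smul_add _ _ _
  map_smul' c f := by funext v; exact smul_comm _ _ _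

end builders

/-- The Hochschild coboundary
`(df)(x₁,…,x_{n+1}) = x₁·f(x₂,…,x_{n+1}) + Σᵢ (-1)^i f(x₁,…,xᵢx_{i+1},…,x_{n+1})
+ (-1)^{n+1} f(x₁,…,x_n)·x_{n+1}`; for `n = 0` it is `(dz)(x) = x·z - z·x`. -/
def dLin (n : ℕ) : Raw L Z n →ₗ[k] Raw L Z (n + 1) :=
  tL k L Z + (∑ j : Fin n, ((-1 : ℤ) ^ ((j : ℕ) + 1)) • mL k L Z j)
    + ((-1 : ℤ) ^ (n + 1)) • lL k L Z

variable (S : Type) [Fintype S] (e : S → L)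

/-- The conditions cutting out `Jⁿ = Hom_{D-D}(Λ^{⊗_D n}, Z)` (and `J⁰ = Z^D`) inside the
raw cochains `Λⁿ → Z`, for `D ⊆ Λ` the subalgebra spanned by the complete system `e` of
orthogonal idempotents: `k`-multilinearity (so that `f` is defined on `Λ^{⊗ n}`),
`D`-balancedness (so that `f` descends to `Λ^{⊗_D n}`), and `D`-bimodule equivariance;
in degree `0` the condition is `e_x·z = z·e_x` for all `x`, i.e. `z ∈ Z^D`. -/
structure IsJ {n : ℕ} (f : Raw L Z n) : Prop where
  addL : ∀ (v : Fin n → L) (i : Fin n) (x y : L),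
    f (Function.update v i (x + y)) = f (Function.update v i x) + f (Function.update v i y)
  smulL : ∀ (v : Fin n → L) (i : Fin n) (c : k) (x : L),
    f (Function.update v i (c • x)) = c • f (Function.update v i x)
  balanced : ∀ (v : Fin n → L) (i : ℕ) (hi : i + 1 < n) (s : S),
    f (Function.update v ⟨i, by omega⟩ (v ⟨i, by omega⟩ * e s))
      = f (Function.update v ⟨i + 1, hi⟩ (e s * v ⟨i + 1, hi⟩))
  leftEq : ∀ (hn : 0 < n) (v : Fin n → L) (s : S),
    f (Function.update v ⟨0, hn⟩ (e s * v ⟨0, hn⟩)) = e s • f v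
  rightEq : ∀ (hn : 0 < n) (v : Fin n → L) (s : S),
    f (Function.update v ⟨n - 1, by omega⟩ (v ⟨n - 1, by omega⟩ * e s)) = op (e s) • f v
  deg0 : n = 0 → ∀ (v : Fin n → L) (s : S), e s • f v = op (e s) • f v

/-- The subspace `Jⁿ ⊆ (Λⁿ → Z)` of cochains, `Jⁿ = Hom_{D-D}(Λ^{⊗_D n}, Z)` for `n ≥ 1`
and `J⁰ = Z^D`. -/
def Jsub (n : ℕ) : Submodule k (Raw L Z n) where
  carrier := {f | IsJ k L Z S e f}
  zero_mem' := by
    refine ⟨?_, ?_, ?_, ?_, ?_, ?_⟩ <;> intros <;> simp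
  add_mem' := by
    intro f g hf hg
    refine ⟨?_, ?_, ?_, ?_, ?_, ?_⟩ <;> intros <;> simp only [Pi.add_apply]
    · rw [hf.addL, hg.addL]; abel
    · rw [hf.smulL, hg.smulL, smul_add]
    · rw [hf.balanced _ _ ‹_›, hg.balanced _ _ ‹_›]
    · rw [hf.leftEq ‹_›, hg.leftEq ‹_›, smul_add]
    · rw [hf.rightEq ‹_›, hg.rightEq ‹_›, smul_add]
    · rw [smul_add, smul_add, hf.deg0 ‹_›, hg.deg0 ‹_›]
  smul_mem' := by
    intro c f hf
    refine ⟨?_, ?_, ?_, ?_, ?_, ?_⟩ <;> intros <;> simp only [Pi.smul_apply]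
    · rw [hf.addL, smul_add]
    · rw [hf.smulL, smul_comm]
    · rw [hf.balanced _ _ ‹_›]
    · rw [hf.leftEq ‹_›, smul_comm]
    · rw [hf.rightEq ‹_›, smul_comm]
    · rw [smul_comm, hf.deg0 ‹_›, smul_comm]

/-- The `n`-cocycles of the complex `J•(Z)`. -/
def Zsub (n : ℕ) : Submodule k (Raw L Z n) :=
  Jsub k L Z S e n ⊓ LinearMap.ker (dLin k L Z n)

/-- The `n`-coboundaries of the complex `J•(Z)`. -/
def Bsub : (n : ℕ) → Submodule k (Raw L Z n)
  | 0 => ⊥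
  | (n + 1) => (Jsub k L Z S e n).map (dLin k L Z n)

/-- The `n`-th cohomology of the complex `J•(Z)`. -/
def Hcoh (n : ℕ) : Type :=
  Zsub k L Z S e n ⧸
    ((Bsub k L Z S e n ⊓ Zsub k L Z S e n).comap (Zsub k L Z S e n).subtype)

instance (n : ℕ) : AddCommGroup (Hcoh k L Z S e n) :=
  inferInstanceAs (AddCommGroup (Zsub k L Z S e n ⧸
    ((Bsub k L Z S e n ⊓ Zsub k L Z S e n).comap (Zsub k L Z S e n).subtype)))

instance (n : ℕ) : Module k (Hcoh k L Z S e n) :=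
  inferInstanceAs (Module k (Zsub k L Z S e n ⧸
    ((Bsub k L Z S e n ⊓ Zsub k L Z S e n).comap (Zsub k L Z S e n).subtype)))

section aux1

set_option linter.unusedSectionVars false
set_option linter.unusedSimpArgs false

/-- Coinduced bimodule `Hom_k(L, Z)`. -/
def CI : Type := L →ₗ[k] Z

namespace CI
variable {k L Z}

instance : AddCommGroup (CI k L Z) := inferInstanceAs (AddCommGroup (L →ₗ[k] Z))
instance : Module k (CI k L Z) := inferInstanceAs (Module k (L →ₗ[k] Z))
instance : FunLike (CI k L Z) L Z := inferInstanceAs (FunLike (L →ₗ[k] Z) L Z)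

@[ext] theorem ext {φ ψ : CI k L Z} (h : ∀ y, φ y = ψ y) : φ = ψ := LinearMap.ext h

/-- constructor -/
def mk (φ : L →ₗ[k] Z) : CI k L Z := φ
@[simp] theorem mk_apply (φ : L →ₗ[k] Z) (y : L) : (mk φ : CI k L Z) y = φ y := rfl

@[simp] theorem add_apply (φ ψ : CI k L Z) (y : L) : (φ + ψ) y = φ y + ψ y := rfl
@[simp] theorem sub_apply (φ ψ : CI k L Z) (y : L) : (φ - ψ) y = φ y - ψ y := rfl
@[simp] theorem neg_apply (φ : CI k L Z) (y : L) : (-φ) y = -φ y := rfl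
@[simp] theorem zero_apply (y : L) : (0 : CI k L Z) y = 0 := rfl
@[simp] theorem smulk_apply (c : k) (φ : CI k L Z) (y : L) : (c • φ) y = c • φ y := rfl
theorem map_add (φ : CI k L Z) (x y : L) : φ (x + y) = φ x + φ y := LinearMap.map_add φ x y
theorem map_smul (φ : CI k L Z) (c : k) (y : L) : φ (c • y) = c • φ y := LinearMap.map_smul φ c y
theorem map_zero (φ : CI k L Z) : φ 0 = 0 := LinearMap.map_zero φ

instance : Module L (CI k L Z) where
  smul a φ := mk (LinearMap.comp (show L →ₗ[k] Z from φ) (LinearMap.mulRight k a))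
  one_smul φ := by ext y; change φ (y * 1) = φ y; rw [mul_one]
  mul_smul a b φ := by ext y; change φ (y * (a * b)) = φ (y * a * b); rw [mul_assoc]
  smul_zero a := rfl
  smul_add a φ ψ := rfl
  add_smul a b φ := by ext y; change φ (y * (a + b)) = φ (y * a) + φ (y * b); rw [mul_add, map_add]
  zero_smul φ := by ext y; change φ (y * 0) = 0; rw [mul_zero, map_zero]

@[simp] theorem smulL_apply (a : L) (φ : CI k L Z) (y : L) : (a • φ) y = φ (y * a) := rfl

instance : Module Lᵐᵒᵖ (CI k L Z) where
  smul a φ := mk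
    { toFun := fun y => a • φ y
      map_add' := fun x y => by rw [map_add, smul_add]
      map_smul' := fun c y => by rw [map_smul, smul_comm]; rfl }
  one_smul φ := by ext y; change (1 : Lᵐᵒᵖ) • φ y = φ y; rw [one_smul]
  mul_smul a b φ := by ext y; change (a * b) • φ y = a • b • φ y; rw [mul_smul]
  smul_zero a := by ext y; change a • (0 : Z) = 0; rw [smul_zero]
  smul_add a φ ψ := by ext y; change a • (φ y + ψ y) = a • φ y + a • ψ y; rw [smul_add]
  add_smul a b φ := by ext y; change (a + b) • φ y = a • φ y + b • φ y; rw [add_smul]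
  zero_smul φ := by ext y; change (0 : Lᵐᵒᵖ) • φ y = 0; rw [zero_smul]

@[simp] theorem smulR_apply (a : Lᵐᵒᵖ) (φ : CI k L Z) (y : L) : (a • φ) y = a • φ y := rfl

instance : SMulCommClass L Lᵐᵒᵖ (CI k L Z) := ⟨fun a b φ => by ext y; simp⟩
instance : IsScalarTower k L (CI k L Z) :=
  ⟨fun c a φ => by ext y; simp [map_smul]⟩
instance : IsScalarTower k Lᵐᵒᵖ (CI k L Z) :=
  ⟨fun c a φ => by ext y; simp⟩

end CI

/-- Bimodule maps. -/
structure BM (Z Z' : Type) [AddCommGroup Z] [Module L Z] [Module Lᵐᵒᵖ Z]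
    [AddCommGroup Z'] [Module L Z'] [Module Lᵐᵒᵖ Z'] where
  toFun : Z →+ Z'
  mapL : ∀ (a : L) (z : Z), toFun (a • z) = a • toFun z
  mapR : ∀ (a : Lᵐᵒᵖ) (z : Z), toFun (a • z) = a • toFun z

variable {k L Z S e}
variable {Z' : Type} [AddCommGroup Z'] [Module k Z'] [Module L Z'] [Module Lᵐᵒᵖ Z']
  [SMulCommClass L Lᵐᵒᵖ Z'] [IsScalarTower k L Z'] [IsScalarTower k Lᵐᵒᵖ Z']

theorem BM.mapk (φ : BM L Z Z') (c : k) (z : Z) : φ.toFun (c • z) = c • φ.toFun z := by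
  rw [← one_smul L z, ← smul_assoc, φ.mapL, smul_assoc, one_smul, one_smul]

/-- pushing a raw cochain along a map -/
def BM.push (φ : BM L Z Z') {n : ℕ} (f : Raw L Z n) : Raw L Z' n := fun v => φ.toFun (f v)

theorem BM.push_J (φ : BM L Z Z') {n : ℕ} {f : Raw L Z n} (hf : IsJ k L Z S e f) :
    IsJ k L Z' S e (φ.push f) := by
  refine ⟨?_, ?_, ?_, ?_, ?_, ?_⟩ <;> intros <;> simp only [BM.push]
  · rw [hf.addL, _root_.map_add]
  · rw [hf.smulL, φ.mapk]
  · rw [hf.balanced _ _ ‹_›]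
  · rw [hf.leftEq ‹_›, φ.mapL]
  · rw [hf.rightEq ‹_›, φ.mapR]
  · rw [← φ.mapL, ← φ.mapR, hf.deg0 ‹_›]

theorem dLin_apply {n : ℕ} (f : Raw L Z n) (v : Fin (n + 1) → L) :
    dLin k L Z n f v = v 0 • f (Fin.tail v)
      + (∑ j : Fin n, ((-1 : ℤ) ^ ((j : ℕ) + 1)) • f (merge v j))
      + ((-1 : ℤ) ^ (n + 1)) • (op (v (Fin.last n)) • f (Fin.init v)) := by
  simp [dLin, tL, mL, lL, LinearMap.sum_apply, Finset.sum_apply]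

theorem BM.push_d (φ : BM L Z Z') {n : ℕ} (f : Raw L Z n) :
    dLin k L Z' n (φ.push f) = φ.push (dLin k L Z n f) := by
  funext v
  simp only [dLin_apply, BM.push, _root_.map_add, map_sum, map_zsmul, φ.mapL, φ.mapR]

/-- `f` is the uncurrying of `g`. -/
def IsCurry {n : ℕ} (f : Raw L Z (n + 1)) (g : Raw L (CI k L Z) n) : Prop :=
  ∀ y x, f (Fin.cons y x) = g x y

theorem IsJ.exists_curry {n : ℕ} {f : Raw L Z (n + 1)} (hf : IsJ k L Z S e f) :
    ∃ g : Raw L (CI k L Z) n, IsCurry f g := by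
  refine ⟨fun x => CI.mk
    { toFun := fun y => f (Fin.cons y x)
      map_add' := fun y y' => ?_
      map_smul' := fun c y => ?_ }, fun y x => rfl⟩
  · have := hf.addL (Fin.cons 0 x) 0 y y'
    simpa only [Fin.update_cons_zero] using this
  · have := hf.smulL (Fin.cons 0 x) 0 c y
    simpa only [Fin.update_cons_zero, RingHom.id_apply] using this

theorem IsCurry.isJ {n : ℕ} {f : Raw L Z (n + 1)} {g : Raw L (CI k L Z) n}
    (h : IsCurry f g) (hf : IsJ k L Z S e f) : IsJ k L (CI k L Z) S e g := by
  refine ⟨?_, ?_, ?_, ?_, ?_, ?_⟩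
  · intro v i x y; ext a
    have := hf.addL (Fin.cons a v) i.succ x y
    simpa only [← Fin.cons_update, h a, CI.add_apply, CI.smulk_apply] using this
  · intro v i c x; ext a
    have := hf.smulL (Fin.cons a v) i.succ c x
    simpa only [← Fin.cons_update, h a, CI.add_apply, CI.smulk_apply] using this
  · intro v i hi s; ext a
    have := hf.balanced (Fin.cons a v) (i + 1) (by omega) s
    have e1 : (⟨i + 1, by omega⟩ : Fin (n + 1)) = Fin.succ ⟨i, by omega⟩ := rfl
    have e2 : (⟨i + 1 + 1, by omega⟩ : Fin (n + 1)) = Fin.succ ⟨i + 1, by omega⟩ := rfl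
    simpa only [e1, e2, Fin.cons_succ, ← Fin.cons_update, h a] using this
  · intro hn v s; ext a
    have := hf.balanced (Fin.cons a v) 0 (by omega) s
    have e1 : (⟨0, by omega⟩ : Fin (n + 1)) = 0 := rfl
    have e2 : (⟨0 + 1, by omega⟩ : Fin (n + 1)) = Fin.succ ⟨0, hn⟩ := rfl
    simp only [e1, e2, Fin.cons_succ, Fin.cons_zero, Fin.update_cons_zero, ← Fin.cons_update,
      h _] at this
    rw [← this]; rfl
  · intro hn v s; ext a
    have := hf.rightEq (by omega) (Fin.cons a v) s
    obtain ⟨m, rfl⟩ : ∃ m, n = m + 1 := ⟨n - 1, by omega⟩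
    have e1 : (⟨m + 1 + 1 - 1, by omega⟩ : Fin (m + 1 + 1)) = Fin.succ ⟨m + 1 - 1, by omega⟩ := rfl
    simpa only [e1, Fin.cons_succ, ← Fin.cons_update, h _, CI.smulR_apply] using this
  · rintro rfl v s; ext a
    have := hf.rightEq (by omega) (Fin.cons a v) s
    have e1 : (⟨0 + 1 - 1, by omega⟩ : Fin (0 + 1)) = 0 := rfl
    simp only [e1, Fin.cons_zero, Fin.update_cons_zero, h _] at this
    exact this

theorem IsCurry.isJ_of {n : ℕ} {f : Raw L Z (n + 1)} {g : Raw L (CI k L Z) n}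
    (h : IsCurry f g) (hg : IsJ k L (CI k L Z) S e g)
    (hl : ∀ s y x, g x (e s * y) = e s • g x y) : IsJ k L Z S e f := by
  have key : ∀ v : Fin (n + 1) → L, v = Fin.cons (v 0) (Fin.tail v) :=
    fun v => (Fin.cons_self_tail v).symm
  refine ⟨?_, ?_, ?_, ?_, ?_, ?_⟩
  · intro v i x y
    rw [key v]; generalize v 0 = a; generalize Fin.tail v = w
    refine Fin.cases ?_ (fun i => ?_) i
    · simp only [Fin.update_cons_zero, h _, CI.map_add]
    · simp only [← Fin.cons_update, h _, hg.addL, CI.add_apply]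
  · intro v i c x
    rw [key v]; generalize v 0 = a; generalize Fin.tail v = w
    refine Fin.cases ?_ (fun i => ?_) i
    · simp only [Fin.update_cons_zero, h _, CI.map_smul]
    · simp only [← Fin.cons_update, h _, hg.smulL, CI.smulk_apply]
  · intro v i hi s
    rw [key v]; generalize v 0 = a; generalize Fin.tail v = w
    cases i with
    | zero =>
      have e1 : (⟨0, by omega⟩ : Fin (n + 1)) = 0 := rfl
      have e2 : (⟨0 + 1, by omega⟩ : Fin (n + 1)) = Fin.succ ⟨0, by omega⟩ := rfl
      simp only [e1, e2, Fin.cons_succ, Fin.cons_zero, Fin.update_cons_zero, ← Fin.cons_update,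
        h _, hg.leftEq (by omega)]
      rfl
    | succ i =>
      have e1 : (⟨i + 1, by omega⟩ : Fin (n + 1)) = Fin.succ ⟨i, by omega⟩ := rfl
      have e2 : (⟨i + 1 + 1, by omega⟩ : Fin (n + 1)) = Fin.succ ⟨i + 1, by omega⟩ := rfl
      simp only [e1, e2, Fin.cons_succ, ← Fin.cons_update, h _]
      rw [hg.balanced w i (by omega)]
  · intro hn v s
    rw [key v]; generalize v 0 = a; generalize Fin.tail v = w
    have e1 : (⟨0, by omega⟩ : Fin (n + 1)) = 0 := rfl
    simp only [e1, Fin.cons_zero, Fin.update_cons_zero, h _, hl]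
  · intro hn v s
    rw [key v]; generalize v 0 = a; generalize Fin.tail v = w
    cases n with
    | zero =>
      have e1 : (⟨0 + 1 - 1, by omega⟩ : Fin (0 + 1)) = 0 := rfl
      simp only [e1, Fin.cons_zero, Fin.update_cons_zero, h _]
      rw [← CI.smulR_apply, ← hg.deg0 rfl w s]; rfl
    | succ m =>
      have e1 : (⟨m + 1 + 1 - 1, by omega⟩ : Fin (m + 1 + 1))
        = Fin.succ ⟨m + 1 - 1, by omega⟩ := rfl
      simp only [e1, Fin.cons_succ, ← Fin.cons_update, h _]
      rw [hg.rightEq (by omega) w s]; rfl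
  · intro h0; omega

theorem IsCurry.left {n : ℕ} {f : Raw L Z (n + 1)} {g : Raw L (CI k L Z) n}
    (h : IsCurry f g) (hf : IsJ k L Z S e f) (s : S) (y : L) (x : Fin n → L) :
    g x (e s * y) = e s • g x y := by
  have := hf.leftEq (by omega) (Fin.cons y x) s
  have e1 : (⟨0, by omega⟩ : Fin (n + 1)) = 0 := rfl
  simpa only [e1, Fin.cons_zero, Fin.update_cons_zero, h _] using this

theorem merge_cons_zero {n : ℕ} (y : L) (x : Fin (n + 1) → L) :
    merge (Fin.cons y x : Fin (n + 2) → L) 0 = Fin.cons (y * x 0) (Fin.tail x) := by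
  funext l
  refine Fin.cases ?_ (fun l => ?_) l
  · simp [merge]
  · simp [merge, Fin.tail]

theorem merge_cons_succ {n : ℕ} (y : L) (x : Fin (n + 1) → L) (j : Fin n) :
    merge (Fin.cons y x : Fin (n + 2) → L) j.succ = Fin.cons y (merge x j) := by
  funext l
  refine Fin.cases ?_ (fun l => ?_) l
  · simp [merge]
  · simp [merge, ← Fin.succ_castSucc]

theorem init_cons {n : ℕ} (y : L) (x : Fin (n + 1) → L) :
    Fin.init (Fin.cons y x : Fin (n + 2) → L) = Fin.cons y (Fin.init x : Fin n → L) := by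
  funext l
  refine Fin.cases ?_ (fun l => ?_) l
  · simp [Fin.init]
  · simp [Fin.init, ← Fin.succ_castSucc]

theorem CI.sum_apply {ι : Type} (s : Finset ι) (φ : ι → CI k L Z) (y : L) :
    (∑ i ∈ s, φ i) y = ∑ i ∈ s, φ i y :=
  map_sum ({ toFun := fun φ : CI k L Z => φ y, map_zero' := rfl, map_add' := fun _ _ => rfl } :
    CI k L Z →+ Z) φ s

theorem CI.zsmul_apply (m : ℤ) (φ : CI k L Z) (y : L) : (m • φ) y = m • φ y :=
  map_zsmul ({ toFun := fun φ : CI k L Z => φ y, map_zero' := rfl, map_add' := fun _ _ => rfl } :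
    CI k L Z →+ Z) m φ

/-- Key recursion for the coboundary. -/
theorem IsCurry.d {n : ℕ} {f : Raw L Z (n + 1)} {g : Raw L (CI k L Z) n} (h : IsCurry f g)
    (y : L) (x : Fin (n + 1) → L) :
    dLin k L Z (n + 1) f (Fin.cons y x) = y • f x - dLin k L (CI k L Z) n g x y := by
  rw [dLin_apply, dLin_apply, Fin.sum_univ_succ]
  simp only [merge_cons_zero, merge_cons_succ, init_cons, Fin.tail_cons, Fin.cons_zero, h _,
    CI.add_apply, CI.smulL_apply, CI.smulR_apply, CI.sum_apply, CI.zsmul_apply]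
  have e1 : (Fin.cons y x : Fin (n + 2) → L) (Fin.last (n + 1)) = x (Fin.last n) := by
    rw [← Fin.succ_last, Fin.cons_succ]
  rw [e1, sub_eq_add_neg, neg_add, neg_add, ← Finset.sum_neg_distrib]
  simp only [← neg_smul, Fin.val_succ, pow_succ (-1 : ℤ) (_ + 1), mul_neg_one]
  simp
  abel

end aux1
section aux2

set_option linter.unusedSectionVars false
set_option linter.unusedSimpArgs false

variable {k L Z S e}
variable {Z' : Type} [AddCommGroup Z'] [Module k Z'] [Module L Z'] [Module Lᵐᵒᵖ Z']
  [SMulCommClass L Lᵐᵒᵖ Z'] [IsScalarTower k L Z'] [IsScalarTower k Lᵐᵒᵖ Z']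

variable (k L Z) in
/-- The embedding `Z → Hom_k(L, Z)`. -/
def iotaCI : BM L Z (CI k L Z) where
  toFun :=
    { toFun := fun z => CI.mk
        { toFun := fun y => y • z
          map_add' := fun a b => add_smul a b z
          map_smul' := fun c a => smul_assoc c a z }
      map_zero' := by ext y; exact smul_zero y
      map_add' := fun z z' => by ext y; exact smul_add y z z' }
  mapL a z := by ext y; exact (mul_smul y a z).symm
  mapR a z := by ext y; exact smul_comm y a z

theorem iotaCI_apply (z : Z) (y : L) : (iotaCI k L Z).toFun z y = y • z := rfl

variable (k L Z) in
/-- Evaluation at one of the inner variable. -/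
def evCI : BM L (CI k L (CI k L Z)) (CI k L Z) where
  toFun :=
    { toFun := fun φ => CI.mk
        { toFun := fun y => φ y 1
          map_add' := fun a b => by rw [CI.map_add]; rfl
          map_smul' := fun c a => by rw [CI.map_smul]; rfl }
      map_zero' := rfl
      map_add' := fun z z' => rfl }
  mapL a z := rfl
  mapR a z := rfl

theorem evCI_apply (z : CI k L (CI k L Z)) (y : L) : (evCI k L Z).toFun z y = z y 1 := rfl

variable (k L Z) in
/-- Defect of left `D`-equivariance. -/
def defCI (a : L) : BM L (CI k L Z) (CI k L Z) where
  toFun :=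
    { toFun := fun φ => CI.mk
        { toFun := fun y => a • φ y - φ (a * y)
          map_add' := fun x y => by rw [mul_add, CI.map_add, CI.map_add, smul_add]; abel
          map_smul' := fun c y => by
            rw [mul_smul_comm, CI.map_smul, CI.map_smul, smul_comm, RingHom.id_apply, smul_sub] }
      map_zero' := by ext y; simp
      map_add' := fun z z' => by ext y; simp; abel }
  mapL b z := by ext y; simp [mul_assoc]
  mapR b z := by ext y; simp [smul_sub, smul_comm]

theorem defCI_apply (a : L) (z : CI k L Z) (y : L) :
  (defCI k L Z a).toFun z y = a • z y - z (a * y) := rfl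

variable (k L Z) in
/-- Averaging. -/
def avCI (e : S → L) : BM L (CI k L Z) (CI k L Z) where
  toFun :=
    { toFun := fun φ => CI.mk
        { toFun := fun y => ∑ s, e s • φ (e s * y)
          map_add' := fun x y => by simp [mul_add, CI.map_add, smul_add, Finset.sum_add_distrib]
          map_smul' := fun c y => by
            simp only [mul_smul_comm, CI.map_smul, smul_comm _ c, RingHom.id_apply,
              Finset.smul_sum] }
      map_zero' := by ext y; simp
      map_add' := fun z z' => by ext y; simp [Finset.sum_add_distrib] }
  mapL b z := by ext y; simp [mul_assoc]
  mapR b z := by ext y; simp [Finset.smul_sum, smul_comm]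

theorem avCI_apply (z : CI k L Z) (y : L) :
  (avCI k L Z e).toFun z y = ∑ s, e s • z (e s * y) := rfl

theorem dLin_zero_apply (f : Raw L Z 0) (y : L) (x : Fin 0 → L) :
    dLin k L Z 0 f (Fin.cons y x) = y • f x - op y • f x := by
  rw [dLin_apply]
  have : (Fin.init (Fin.cons y x : Fin 1 → L) : Fin 0 → L) = x := Subsingleton.elim _ _
  have h2 : (Fin.cons y x : Fin 1 → L) (Fin.last 0) = y := rfl
  rw [this, h2]
  simp [sub_eq_add_neg]

theorem d_J_zero {f : Raw L Z 0} (hf : IsJ k L Z S e f) :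
    IsJ k L Z S e (dLin k L Z 0 f) := by
  have hc : IsCurry (k := k) (dLin k L Z 0 f) (fun x => CI.mk
    { toFun := fun y => y • f x - op y • f x
      map_add' := fun a b => by rw [add_smul, MulOpposite.op_add, add_smul]; abel
      map_smul' := fun c a => by
        rw [smul_assoc, MulOpposite.op_smul, smul_assoc, RingHom.id_apply, smul_sub] }) :=
    fun y x => dLin_zero_apply f y x
  refine hc.isJ_of ⟨?_, ?_, ?_, ?_, ?_, ?_⟩ ?_
  · intro v i; exact i.elim0
  · intro v i; exact i.elim0
  · intro v i hi; omega
  · intro hi; omega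
  · intro hi; omega
  · intro _ x s
    ext y
    have := hf.deg0 rfl x s
    simp only [CI.smulL_apply, CI.smulR_apply, CI.mk_apply, LinearMap.coe_mk, AddHom.coe_mk,
      MulOpposite.op_mul, mul_smul, smul_sub, this]
    rw [smul_comm]
  · intro s y x
    have := hf.deg0 rfl x s
    simp only [CI.smulL_apply, CI.smulR_apply, CI.mk_apply, LinearMap.coe_mk, AddHom.coe_mk,
      MulOpposite.op_mul, mul_smul, smul_sub, ← this]
    rw [smul_comm (e s) (op y)]

theorem IsCurry.curry_d {n : ℕ} {f : Raw L Z (n + 1)} {g : Raw L (CI k L Z) n}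
    (h : IsCurry f g) :
    IsCurry (dLin k L Z (n + 1) f) ((iotaCI k L Z).push f - dLin k L (CI k L Z) n g) := by
  intro y x
  rw [h.d]; rfl

theorem d_J (n : ℕ) : ∀ {Z : Type} [AddCommGroup Z] [Module k Z] [Module L Z] [Module Lᵐᵒᵖ Z]
    [SMulCommClass L Lᵐᵒᵖ Z] [IsScalarTower k L Z] [IsScalarTower k Lᵐᵒᵖ Z]
    {f : Raw L Z n} (_ : IsJ k L Z S e f), IsJ k L Z S e (dLin k L Z n f) := by
  induction n with
  | zero => intro Z _ _ _ _ _ _ _ f hf; exact d_J_zero hf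
  | succ n ih =>
    intro Z _ _ _ _ _ _ _ f hf
    obtain ⟨g, hg⟩ := hf.exists_curry
    refine hg.curry_d.isJ_of ?_ ?_
    · exact (Jsub k L (CI k L Z) S e (n + 1)).sub_mem ((iotaCI k L Z).push_J hf)
        (ih (hg.isJ hf))
    · intro s y x
      have h0 : (defCI k L Z (e s)).push g = 0 := by
        funext x; ext y
        simp only [BM.push, defCI_apply, hg.left hf, sub_self]; rfl
      have h1 := congrFun ((defCI k L Z (e s)).push_d (k := k) g) x
      rw [h0, _root_.map_zero] at h1
      have h2 := congrArg (fun φ : CI k L Z => φ y) h1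
      simp only [BM.push, defCI_apply, Pi.zero_apply, CI.zero_apply] at h2
      simp only [Pi.sub_apply, CI.sub_apply, smul_sub]
      rw [sub_eq_zero.1 h2.symm]
      simp only [BM.push, iotaCI_apply, mul_smul]

theorem dd_zero (n : ℕ) : ∀ {Z : Type} [AddCommGroup Z] [Module k Z] [Module L Z]
    [Module Lᵐᵒᵖ Z] [SMulCommClass L Lᵐᵒᵖ Z] [IsScalarTower k L Z] [IsScalarTower k Lᵐᵒᵖ Z]
    {f : Raw L Z n} (_ : IsJ k L Z S e f), dLin k L Z (n + 1) (dLin k L Z n f) = 0 := by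
  induction n with
  | zero =>
    intro Z _ _ _ _ _ _ _ f hf
    obtain ⟨g, hg⟩ := (d_J_zero hf).exists_curry
    funext v
    rw [← Fin.cons_self_tail v]; generalize v 0 = y; generalize Fin.tail v = w
    rw [← Fin.cons_self_tail w]; generalize w 0 = x; generalize Fin.tail w = u
    rw [hg.d, dLin_zero_apply, dLin_zero_apply]
    simp only [CI.sub_apply, CI.smulL_apply, CI.smulR_apply, ← hg _ _, dLin_zero_apply,
      smul_sub, mul_smul, MulOpposite.op_mul]
    rw [smul_comm y (op x)]
    simp
  | succ n ih =>
    intro Z _ _ _ _ _ _ _ f hf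
    obtain ⟨g, hg⟩ := hf.exists_curry
    funext v
    rw [← Fin.cons_self_tail v]; generalize v 0 = y; generalize Fin.tail v = w
    rw [hg.curry_d.d, _root_.map_sub, ih (hg.isJ hf), BM.push_d]
    simp [BM.push, iotaCI_apply]

/-- Contracting homotopy on the coinduced bimodule. -/
theorem exact_CI {n : ℕ} {f : Raw L (CI k L Z) (n + 1)} (hf : IsJ k L (CI k L Z) S e f)
    (hd : dLin k L (CI k L Z) (n + 1) f = 0) :
    ∃ g : Raw L (CI k L Z) n, IsJ k L (CI k L Z) S e g ∧ dLin k L (CI k L Z) n g = f := by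
  obtain ⟨g, hg⟩ := hf.exists_curry
  refine ⟨(evCI k L Z).push g, (evCI k L Z).push_J (hg.isJ hf), ?_⟩
  rw [BM.push_d]
  funext x; ext y
  have := hg.d y x
  rw [hd] at this
  have h2 := sub_eq_zero.1 this.symm
  simp only [BM.push, evCI_apply, ← h2, CI.smulL_apply, one_mul]

theorem lift_J (hidem : ∀ x : S, e x * e x = e x)
    (horth : ∀ x y : S, x ≠ y → e x * e y = 0)
    (hsum : ∑ x : S, e x = 1) (n : ℕ) :
    ∀ {Z Z' : Type} [AddCommGroup Z] [Module k Z] [Module L Z]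
    [Module Lᵐᵒᵖ Z] [SMulCommClass L Lᵐᵒᵖ Z] [IsScalarTower k L Z] [IsScalarTower k Lᵐᵒᵖ Z]
    [AddCommGroup Z'] [Module k Z'] [Module L Z'] [Module Lᵐᵒᵖ Z']
    [SMulCommClass L Lᵐᵒᵖ Z'] [IsScalarTower k L Z'] [IsScalarTower k Lᵐᵒᵖ Z']
    (π : BM L Z Z') (_ : Function.Surjective π.toFun)
    {f : Raw L Z' n} (_ : IsJ k L Z' S e f), ∃ g : Raw L Z n, IsJ k L Z S e g ∧ π.push g = f := by
  classical
  have hmul : ∀ s t, e s * e t = if s = t then e s else 0 := by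
    intro s t
    split_ifs with h
    · rw [← h, hidem]
    · exact horth s t h
  induction n with
  | zero =>
    intro Z Z' _ _ _ _ _ _ _ _ _ _ _ _ _ _ π hπ f hf
    obtain ⟨z, hz⟩ := hπ (f Fin.elim0)
    refine ⟨fun _ => ∑ s, e s • op (e s) • z, ⟨?_, ?_, ?_, ?_, ?_, ?_⟩, ?_⟩
    · intro v i; exact i.elim0
    · intro v i; exact i.elim0
    · intro v i hi; omega
    · intro hi; omega
    · intro hi; omega
    · intro _ v t
      simp only [Finset.smul_sum]
      refine Finset.sum_congr rfl fun s _ => ?_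
      rw [smul_smul, ← smul_comm (e s) (op (e t)), smul_smul, ← MulOpposite.op_mul, hmul, hmul]
      by_cases h : s = t
      · subst h; simp
      · simp [h, Ne.symm h]
    · funext v
      have hv : v = Fin.elim0 := Subsingleton.elim _ _
      simp only [BM.push, map_sum, π.mapL, π.mapR, hz, hv]
      simp only [← hf.deg0 rfl, smul_smul, hidem]
      rw [← Finset.sum_smul, hsum, one_smul]
  | succ n ih =>
    intro Z Z' _ _ _ _ _ _ _ _ _ _ _ _ _ _ π hπ f hf
    obtain ⟨f', hf'⟩ := hf.exists_curry
    let πk : Z →ₗ[k] Z' := { π.toFun with map_smul' := fun c z => π.mapk c z }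
    obtain ⟨σ, hσ⟩ := πk.exists_rightInverse_of_surjective (LinearMap.range_eq_top.2 hπ)
    have hσ' : ∀ z, π.toFun (σ z) = z := fun z => LinearMap.congr_fun hσ z
    let Cπ : BM L (CI k L Z) (CI k L Z') :=
      { toFun :=
          { toFun := fun φ => CI.mk (πk.comp (show L →ₗ[k] Z from φ))
            map_zero' := by ext y; exact πk.map_zero
            map_add' := fun φ ψ => by ext y; exact πk.map_add _ _ }
        mapL := fun a φ => rfl
        mapR := fun a φ => by ext y; exact π.mapR a (φ y) }
    have hCπ : ∀ φ y, Cπ.toFun φ y = π.toFun (φ y) := fun φ y => rfl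
    have hsur : Function.Surjective Cπ.toFun := by
      intro ψ
      refine ⟨CI.mk (σ.comp (show L →ₗ[k] Z' from ψ)), ?_⟩
      ext y; exact hσ' (ψ y)
    obtain ⟨g, hg, hgf⟩ := ih Cπ hsur (hf'.isJ hf)
    let F : Raw L Z (n + 1) := fun v => ((avCI k L Z e).push g) (Fin.tail v) (v 0)
    have hF : IsCurry F ((avCI k L Z e).push g) := fun y x => by
      simp only [F, Fin.tail_cons, Fin.cons_zero]
    refine ⟨F, hF.isJ_of ((avCI k L Z e).push_J hg) ?_, ?_⟩
    · intro s y x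
      simp only [BM.push, avCI_apply, Finset.smul_sum]
      refine Finset.sum_congr rfl fun t _ => ?_
      rw [← mul_assoc, smul_smul, hmul, hmul]
      by_cases h : s = t
      · subst h; simp
      · simp [h, Ne.symm h, CI.map_zero]
    · funext v
      rw [← Fin.cons_self_tail v]; generalize v 0 = y; generalize Fin.tail v = x
      simp only [BM.push, hF y x, avCI_apply, map_sum, π.mapL, ← hCπ]
      have : ∀ x, Cπ.toFun (g x) = f' x := fun x => congrFun hgf x
      simp only [this, hf'.left hf, smul_smul, hidem]
      rw [← Finset.sum_smul, hsum, one_smul, hf']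

end aux2
section aux3

set_option linter.unusedSectionVars false
set_option linter.unusedSimpArgs false

section envsmul
variable {k L Z}

theorem env_tmul_smul (a : L) (b : Lᵐᵒᵖ) (z : Z) :
    (a ⊗ₜ[k] b : L ⊗[k] Lᵐᵒᵖ) • z = a • b • z := TensorProduct.Algebra.smul_def a b z

variable (k) in
theorem env_smulL (a : L) (z : Z) : a • z = (a ⊗ₜ[k] (1 : Lᵐᵒᵖ) : L ⊗[k] Lᵐᵒᵖ) • z := by
  rw [env_tmul_smul, one_smul]

variable (k) in
theorem env_smulR (a : Lᵐᵒᵖ) (z : Z) : a • z = ((1 : L) ⊗ₜ[k] a : L ⊗[k] Lᵐᵒᵖ) • z := by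
  rw [env_tmul_smul, one_smul]

variable (L) in
theorem env_smulk (c : k) (z : Z) :
    c • z = ((c • (1 : L)) ⊗ₜ[k] (1 : Lᵐᵒᵖ) : L ⊗[k] Lᵐᵒᵖ) • z := by
  rw [env_tmul_smul, one_smul, smul_assoc, one_smul]

variable {Z' : Type} [AddCommGroup Z'] [Module k Z'] [Module L Z'] [Module Lᵐᵒᵖ Z']
  [SMulCommClass L Lᵐᵒᵖ Z'] [IsScalarTower k L Z'] [IsScalarTower k Lᵐᵒᵖ Z']

def BM.ofE (φ : Z →ₗ[L ⊗[k] Lᵐᵒᵖ] Z') : BM L Z Z' where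
  toFun := φ.toAddMonoidHom
  mapL a z := by
    change φ (a • z) = a • φ z
    rw [env_smulL k a z, _root_.map_smul, ← env_smulL]
  mapR a z := by
    change φ (a • z) = a • φ z
    rw [env_smulR k a z, _root_.map_smul, ← env_smulR]

theorem BM.ofE_apply (φ : Z →ₗ[L ⊗[k] Lᵐᵒᵖ] Z') (z : Z) : (BM.ofE φ).toFun z = φ z := rfl

variable (k) in
/-- Bimodule maps are `L^e`-linear. -/
def BM.toE (φ : BM L Z Z') : Z →ₗ[L ⊗[k] Lᵐᵒᵖ] Z' where
  toFun := φ.toFun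
  map_add' := _root_.map_add φ.toFun
  map_smul' r z := by
    rw [RingHom.id_apply]
    induction r using TensorProduct.induction_on with
    | zero =>
      exact (congrArg φ.toFun (zero_smul (L ⊗[k] Lᵐᵒᵖ) z)).trans
        ((_root_.map_zero φ.toFun).trans (zero_smul (L ⊗[k] Lᵐᵒᵖ) (φ.toFun z)).symm)
    | tmul a b => rw [env_tmul_smul, env_tmul_smul, φ.mapL, φ.mapR]
    | add x y hx hy =>
      refine (congrArg φ.toFun (add_smul x y z)).trans
        ((_root_.map_add φ.toFun _ _).trans (Eq.trans ?_ (add_smul x y _).symm))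
      rw [hx, hy]

theorem BM.toE_apply (φ : BM L Z Z') (z : Z) : BM.toE k φ z = φ.toFun z := rfl

end envsmul

/-- An `L^e`-module regarded as a bimodule. -/
def Res (_k _L M : Type) : Type := M

section res
variable {k L}
variable (M : Type) [AddCommGroup M] [Module (L ⊗[k] Lᵐᵒᵖ) M]

instance : AddCommGroup (Res k L M) := inferInstanceAs (AddCommGroup M)
instance : Module k (Res k L M) := Module.compHom M (algebraMap k (L ⊗[k] Lᵐᵒᵖ))
instance : Module L (Res k L M) := Module.compHom M
  (Algebra.TensorProduct.includeLeft : L →ₐ[k] L ⊗[k] Lᵐᵒᵖ).toRingHom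
instance : Module Lᵐᵒᵖ (Res k L M) := Module.compHom M
  (Algebra.TensorProduct.includeRight : Lᵐᵒᵖ →ₐ[k] L ⊗[k] Lᵐᵒᵖ).toRingHom

variable {M}
/-- inclusion -/
def toRes (m : M) : Res k L M := m
theorem toRes_add (m m' : M) : toRes (k := k) (L := L) (m + m') = toRes m + toRes m' := rfl
theorem smulk_toRes (c : k) (m : M) :
    c • toRes (k := k) (L := L) m = toRes ((algebraMap k (L ⊗[k] Lᵐᵒᵖ) c) • m) := rfl
theorem smulL_toRes (a : L) (m : M) :
    a • toRes (k := k) (L := L) m = toRes ((a ⊗ₜ[k] (1 : Lᵐᵒᵖ) : L ⊗[k] Lᵐᵒᵖ) • m) := rfl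
theorem smulR_toRes (a : Lᵐᵒᵖ) (m : M) :
    a • toRes (k := k) (L := L) m = toRes (((1 : L) ⊗ₜ[k] a : L ⊗[k] Lᵐᵒᵖ) • m) := rfl

variable (M)
instance : SMulCommClass L Lᵐᵒᵖ (Res k L M) := ⟨fun a b z => by
  change a • b • toRes (k := k) (L := L) (show M from z) = b • a • toRes (show M from z)
  rw [smulR_toRes, smulL_toRes, smulL_toRes, smulR_toRes, smul_smul, smul_smul]
  simp⟩
instance : IsScalarTower k L (Res k L M) := ⟨fun a b z => by
  change (a • b) • toRes (k := k) (L := L) (show M from z) = a • b • toRes (show M from z)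
  rw [smulL_toRes, smulL_toRes, smulk_toRes, smul_smul, ← Algebra.smul_def,
    TensorProduct.smul_tmul']⟩
instance : IsScalarTower k Lᵐᵒᵖ (Res k L M) := ⟨fun a b z => by
  change (a • b) • toRes (k := k) (L := L) (show M from z) = a • b • toRes (show M from z)
  rw [smulR_toRes, smulR_toRes, smulk_toRes, smul_smul, ← Algebra.smul_def,
    TensorProduct.tmul_smul]⟩

/-- The identity is an `L^e`-linear equivalence. -/
def resE : M ≃ₗ[L ⊗[k] Lᵐᵒᵖ] Res k L M where
  toFun := toRes
  invFun := fun m => m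
  left_inv := fun _ => rfl
  right_inv := fun _ => rfl
  map_add' := fun _ _ => rfl
  map_smul' r z := by
    rw [RingHom.id_apply]
    induction r using TensorProduct.induction_on with
    | zero =>
      exact (congrArg (toRes (k := k) (L := L)) (zero_smul (L ⊗[k] Lᵐᵒᵖ) z)).trans
        (zero_smul (L ⊗[k] Lᵐᵒᵖ) (toRes (k := k) (L := L) z)).symm
    | tmul a b =>
      rw [env_tmul_smul, smulR_toRes, smulL_toRes, smul_smul]
      simp
    | add x y hx hy =>
      refine (congrArg (toRes (k := k) (L := L)) (add_smul x y z)).trans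
        ((toRes_add _ _).trans (Eq.trans ?_ (add_smul x y _).symm))
      rw [hx, hy]

end res

/-- Free modules. -/
def FreeM (A X : Type) [Ring A] : Type := X →₀ A

namespace FreeM
variable {A X : Type} [Ring A]
instance : AddCommGroup (FreeM A X) := inferInstanceAs (AddCommGroup (X →₀ A))
instance : Module A (FreeM A X) := inferInstanceAs (Module A (X →₀ A))
instance : Module.Free A (FreeM A X) := inferInstanceAs (Module.Free A (X →₀ A))
/-- Basis elements. -/
def bb (x : X) : FreeM A X := Finsupp.single x (1 : A)
variable {M : Type} [AddCommGroup M] [Module A M]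
/-- Universal property. -/
def lc (f : X → M) : FreeM A X →ₗ[A] M := Finsupp.linearCombination A f
theorem lc_bb (f : X → M) (x : X) : lc f (bb x : FreeM A X) = f x := by
  refine (Finsupp.linearCombination_single A (1 : A) x).trans ?_
  rw [one_smul]
theorem hom_ext {φ ψ : FreeM A X →ₗ[A] M} (h : ∀ x, φ (bb x) = ψ (bb x)) : φ = ψ :=
  Finsupp.lhom_ext' fun v => LinearMap.ext_ring (h v)
end FreeM

/-- The relation submodule. -/
def Nrel (n : ℕ) : Submodule (L ⊗[k] Lᵐᵒᵖ) (FreeM (L ⊗[k] Lᵐᵒᵖ) (Fin n → L)) where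
  carrier := {ξ | ∀ (Z : Type) [AddCommGroup Z] [Module k Z] [Module L Z]
    [Module Lᵐᵒᵖ Z] [SMulCommClass L Lᵐᵒᵖ Z] [IsScalarTower k L Z] [IsScalarTower k Lᵐᵒᵖ Z]
    (f : Raw L Z n) (_ : IsJ k L Z S e f), FreeM.lc (A := L ⊗[k] Lᵐᵒᵖ) f ξ = 0}
  zero_mem' := by intro Z _ _ _ _ _ _ _ f hf; exact _root_.map_zero _
  add_mem' := by
    intro a b ha hb Z _ _ _ _ _ _ _ f hf
    rw [_root_.map_add, ha Z f hf, hb Z f hf, add_zero]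
  smul_mem' := by
    intro c a ha Z _ _ _ _ _ _ _ f hf
    rw [_root_.map_smul, ha Z f hf, smul_zero]

/-- The `n`-th term of the relative bar resolution. -/
def PP (n : ℕ) : Type :=
  Res k L ((FreeM (L ⊗[k] Lᵐᵒᵖ) (Fin n → L)) ⧸ Nrel k L S e n)

section PPinst
variable (n : ℕ)
instance : AddCommGroup (PP k L S e n) := inferInstanceAs (AddCommGroup (Res k L _))
instance : Module k (PP k L S e n) := inferInstanceAs (Module k (Res k L _))
instance : Module L (PP k L S e n) := inferInstanceAs (Module L (Res k L _))
instance : Module Lᵐᵒᵖ (PP k L S e n) := inferInstanceAs (Module Lᵐᵒᵖ (Res k L _))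
instance : SMulCommClass L Lᵐᵒᵖ (PP k L S e n) :=
  inferInstanceAs (SMulCommClass L Lᵐᵒᵖ (Res k L _))
instance : IsScalarTower k L (PP k L S e n) := inferInstanceAs (IsScalarTower k L (Res k L _))
instance : IsScalarTower k Lᵐᵒᵖ (PP k L S e n) :=
  inferInstanceAs (IsScalarTower k Lᵐᵒᵖ (Res k L _))

/-- The projection. -/
def mkP : (FreeM (L ⊗[k] Lᵐᵒᵖ) (Fin n → L)) →ₗ[L ⊗[k] Lᵐᵒᵖ] PP k L S e n :=
  (resE (k := k) (L := L) ((FreeM (L ⊗[k] Lᵐᵒᵖ) (Fin n → L)) ⧸ Nrel k L S e n)).toLinearMap.comp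
    (Nrel k L S e n).mkQ

theorem mkP_surjective : Function.Surjective (mkP k L S e n) :=
  (resE (k := k) (L := L) _).surjective.comp (Nrel k L S e n).mkQ_surjective

theorem ker_mkP : LinearMap.ker (mkP k L S e n) = Nrel k L S e n := by
  ext x; exact Submodule.Quotient.mk_eq_zero (Nrel k L S e n)

/-- The universal cochain. -/
def uu : Raw L (PP k L S e n) n := fun v => mkP k L S e n (FreeM.bb v)

variable {k L S e n}

theorem mkP_eq {a b : (FreeM (L ⊗[k] Lᵐᵒᵖ) (Fin n → L))}
    (h : ∀ (Z : Type) [AddCommGroup Z] [Module k Z] [Module L Z]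
    [Module Lᵐᵒᵖ Z] [SMulCommClass L Lᵐᵒᵖ Z] [IsScalarTower k L Z] [IsScalarTower k Lᵐᵒᵖ Z]
    (f : Raw L Z n) (_ : IsJ k L Z S e f), FreeM.lc (A := L ⊗[k] Lᵐᵒᵖ) f a
      = FreeM.lc (A := L ⊗[k] Lᵐᵒᵖ) f b) :
    mkP k L S e n a = mkP k L S e n b := by
  rw [← sub_eq_zero, ← _root_.map_sub, ← LinearMap.mem_ker, ker_mkP]
  intro Z _ _ _ _ _ _ _ f hf
  rw [_root_.map_sub, h Z f hf, sub_self]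

theorem uu_J : IsJ k L (PP k L S e n) S e (uu k L S e n) := by
  refine ⟨?_, ?_, ?_, ?_, ?_, ?_⟩ <;> intros <;>
    simp only [uu, env_smulL k (_ : L) (_ : PP k L S e n), env_smulR k (_ : Lᵐᵒᵖ) (_ : PP k L S e n),
      env_smulk L (_ : k) (_ : PP k L S e n)] <;>
    (try simp only [← _root_.map_add, ← _root_.map_smul]) <;>
    refine mkP_eq ?_ <;> intro Z _ _ _ _ _ _ _ f hf <;>
    simp only [_root_.map_add, _root_.map_smul, FreeM.lc_bb] <;>
    (try simp only [← env_smulL, ← env_smulR, ← env_smulk])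
  · exact hf.addL _ _ _ _
  · rw [smul_assoc, one_smul]; exact hf.smulL _ _ _ _
  · exact hf.balanced _ _ ‹_› _
  · exact hf.leftEq ‹_› _ _
  · exact hf.rightEq ‹_› _ _
  · exact hf.deg0 ‹_› _ _

variable {Z}

theorem PP_hom_ext {φ ψ : PP k L S e n →ₗ[L ⊗[k] Lᵐᵒᵖ] Z}
    (h : ∀ v, φ (uu k L S e n v) = ψ (uu k L S e n v)) : φ = ψ := by
  have : φ.comp (mkP k L S e n) = ψ.comp (mkP k L S e n) := by
    exact FreeM.hom_ext h
  ext x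
  obtain ⟨y, rfl⟩ := mkP_surjective k L S e n x
  exact LinearMap.congr_fun this y

/-- The universal property. -/
def PPdesc (f : Raw L Z n) (hf : IsJ k L Z S e f) : PP k L S e n →ₗ[L ⊗[k] Lᵐᵒᵖ] Z :=
  ((Nrel k L S e n).liftQ (FreeM.lc (A := L ⊗[k] Lᵐᵒᵖ) f)
    (fun _ hx => hx Z f hf)).comp (resE (k := k) (L := L) _).symm.toLinearMap

theorem PPdesc_uu (f : Raw L Z n) (hf : IsJ k L Z S e f) (v : Fin n → L) :
    PPdesc f hf (uu k L S e n v) = f v := by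
  change FreeM.lc (A := L ⊗[k] Lᵐᵒᵖ) f (FreeM.bb v) = f v
  rw [FreeM.lc_bb]

end PPinst

end aux3
section aux4

set_option linter.unusedSectionVars false
set_option linter.unusedSimpArgs false

/-- The bar differential. -/
def dP (n : ℕ) : PP k L S e (n + 1) →ₗ[L ⊗[k] Lᵐᵒᵖ] PP k L S e n :=
  PPdesc (dLin k L _ n (uu k L S e n)) (d_J n uu_J)

variable {k L Z S e}

theorem hom_d {n : ℕ} (φ : PP k L S e n →ₗ[L ⊗[k] Lᵐᵒᵖ] Z) (v : Fin (n + 1) → L) :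
    φ (dP k L S e n (uu k L S e (n + 1) v)) = dLin k L Z n (fun w => φ (uu k L S e n w)) v := by
  rw [dP, PPdesc_uu]
  exact (congrFun ((BM.ofE φ).push_d (k := k) (uu k L S e n)) v).symm

theorem hom_J {n : ℕ} (φ : PP k L S e n →ₗ[L ⊗[k] Lᵐᵒᵖ] Z) :
    IsJ k L Z S e (fun w => φ (uu k L S e n w)) :=
  (BM.ofE φ).push_J uu_J

theorem dP_comp (n : ℕ) : (dP k L S e n).comp (dP k L S e (n + 1)) = 0 := by
  refine PP_hom_ext fun v => ?_
  rw [LinearMap.comp_apply, hom_d]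
  have : (fun w => dP k L S e n (uu k L S e (n + 1) w)) = dLin k L _ n (uu k L S e n) := by
    funext w; rw [dP, PPdesc_uu]
  rw [this, dd_zero n uu_J]
  rfl

theorem PP_projective (hidem : ∀ x : S, e x * e x = e x)
    (horth : ∀ x y : S, x ≠ y → e x * e y = 0)
    (hsum : ∑ x : S, e x = 1) (n : ℕ) : Module.Projective (L ⊗[k] Lᵐᵒᵖ) (PP k L S e n) := by
  let F := FreeM (L ⊗[k] Lᵐᵒᵖ) (Fin n → L)
  let p : Res k L F →ₗ[L ⊗[k] Lᵐᵒᵖ] PP k L S e n :=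
    (mkP k L S e n).comp (resE (k := k) (L := L) F).symm.toLinearMap
  have hp : Function.Surjective p :=
    (mkP_surjective k L S e n).comp (resE (k := k) (L := L) F).symm.surjective
  obtain ⟨g, hg, hgu⟩ := lift_J hidem horth hsum n (BM.ofE p) hp (uu_J (k := k) (n := n))
  refine Module.Projective.of_split
    ((resE (k := k) (L := L) F).symm.toLinearMap.comp (PPdesc g hg)) (mkP k L S e n) ?_
  refine PP_hom_ext fun v => ?_
  change p (PPdesc g hg (uu k L S e n v)) = _
  rw [PPdesc_uu]
  exact congrFun hgu v

theorem iotaCI_inj {z : Z} (h : (iotaCI k L Z).toFun z = 0) : z = 0 := by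
  have := congrArg (fun φ : CI k L Z => φ 1) h
  simpa [iotaCI_apply] using this

theorem dP_exact (n : ℕ) (x : PP k L S e (n + 1)) (hx : dP k L S e n x = 0) :
    ∃ y, dP k L S e (n + 1) y = x := by
  let Q0 := PP k L S e (n + 1) ⧸ LinearMap.range (dP k L S e (n + 1))
  let q : PP k L S e (n + 1) →ₗ[L ⊗[k] Lᵐᵒᵖ] Res k L Q0 :=
    (resE (k := k) (L := L) Q0).toLinearMap.comp (LinearMap.range (dP k L S e (n + 1))).mkQ
  have hq : ∀ x, q x = 0 ↔ x ∈ LinearMap.range (dP k L S e (n + 1)) := fun x =>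
    Submodule.Quotient.mk_eq_zero _
  let ι := BM.toE k (iotaCI k L (Res k L Q0))
  let r := ι.comp q
  have hd : dLin k L _ (n + 1) (fun w => r (uu k L S e (n + 1) w)) = 0 := by
    funext v
    rw [← hom_d]
    change ι (q _) = _
    rw [(hq _).2 ⟨_, rfl⟩, _root_.map_zero]
    rfl
  obtain ⟨g, hg, hgd⟩ := exact_CI (hom_J r) hd
  have hr : r = (PPdesc g hg).comp (dP k L S e n) := by
    refine PP_hom_ext fun v => ?_
    symm
    change PPdesc g hg (dP k L S e n (uu k L S e (n + 1) v)) = _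
    rw [hom_d]
    simp only [PPdesc_uu]
    exact congrFun hgd v
  have : r x = 0 := by rw [hr, LinearMap.comp_apply, hx, _root_.map_zero]
  exact (hq x).1 (iotaCI_inj this)

theorem one_J : IsJ k L L S e (n := 0) (fun _ => (1 : L)) := by
  refine ⟨fun _ i => i.elim0, fun _ i => i.elim0, fun _ i hi => absurd hi (by omega),
    fun h => absurd h (by omega), fun h => absurd h (by omega), fun _ v s => ?_⟩
  simp

variable (k L S e) in
/-- The augmentation. -/
def augP : PP k L S e 0 →ₗ[L ⊗[k] Lᵐᵒᵖ] L := PPdesc (fun _ => (1 : L)) one_J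

theorem aug_uu (v : Fin 0 → L) : augP k L S e (uu k L S e 0 v) = 1 := PPdesc_uu _ _ _

theorem aug_surj : Function.Surjective (augP k L S e) := fun a =>
  ⟨a • uu k L S e 0 (fun i => i.elim0), by
    rw [env_smulL k, _root_.map_smul, aug_uu, ← env_smulL]; simp⟩

theorem aug_d : (augP k L S e).comp (dP k L S e 0) = 0 := by
  refine PP_hom_ext fun v => ?_
  rw [LinearMap.comp_apply, hom_d]
  simp only [aug_uu]
  rw [← Fin.cons_self_tail v, dLin_zero_apply]
  simp

theorem aug_exact (x : PP k L S e 0) (hx : augP k L S e x = 0) :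
    ∃ y, dP k L S e 0 y = x := by
  let Q0 := PP k L S e 0 ⧸ LinearMap.range (dP k L S e 0)
  let q : PP k L S e 0 →ₗ[L ⊗[k] Lᵐᵒᵖ] Res k L Q0 :=
    (resE (k := k) (L := L) Q0).toLinearMap.comp (LinearMap.range (dP k L S e 0)).mkQ
  have hq : ∀ x, q x = 0 ↔ x ∈ LinearMap.range (dP k L S e 0) := fun x =>
    Submodule.Quotient.mk_eq_zero _
  let v0 : Fin 0 → L := fun i => i.elim0
  let z := q (uu k L S e 0 v0)
  have hz : ∀ a : L, op a • z = a • z := by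
    intro a
    have h := hom_d q (Fin.cons a v0)
    rw [(hq _).2 ⟨_, rfl⟩, dLin_zero_apply] at h
    exact (sub_eq_zero.1 h.symm).symm
  let s : BM L L (Res k L Q0) :=
    { toFun := ⟨⟨fun a => a • z, zero_smul _ _⟩, fun a b => add_smul a b z⟩
      mapL := fun a b => mul_smul a b z
      mapR := fun a b => by
        change (a • b) • z = a • b • z
        rw [← smul_comm b a z]
        rw [← MulOpposite.op_unop a, hz, ← mul_smul]
        rfl }
  have hr : q = (BM.toE k s).comp (augP k L S e) := by
    refine PP_hom_ext fun v => ?_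
    symm
    change BM.toE k s (augP k L S e (uu k L S e 0 v)) = _
    rw [aug_uu]
    change (1 : L) • z = _
    rw [one_smul, Subsingleton.elim v v0]
  refine (hq x).1 ?_
  rw [hr, LinearMap.comp_apply, hx, _root_.map_zero]

end aux4
section aux5

set_option linter.unusedSectionVars false
set_option linter.unusedSimpArgs false

/-- The bar complex. -/
def PC : ChainComplex (ModuleCat (L ⊗[k] Lᵐᵒᵖ)) ℕ :=
  ChainComplex.of (fun n => ModuleCat.of (L ⊗[k] Lᵐᵒᵖ) (PP k L S e n))
    (fun n => ModuleCat.ofHom (dP k L S e n))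
    (fun n => by
      rw [← ModuleCat.ofHom_comp, dP_comp]
      rfl)

theorem PC_d (n : ℕ) : (PC k L S e).d (n + 1) n = ModuleCat.ofHom (dP k L S e n) :=
  ChainComplex.of_d (fun n => ModuleCat.of (L ⊗[k] Lᵐᵒᵖ) (PP k L S e n))
    (fun n => ModuleCat.ofHom (dP k L S e n)) n

/-- The augmentation as a chain map. -/
def PCπ : PC k L S e ⟶ (ChainComplex.single₀ _).obj (ModuleCat.of (L ⊗[k] Lᵐᵒᵖ) L) :=
  ((PC k L S e).toSingle₀Equiv _).symm ⟨ModuleCat.ofHom (augP k L S e), by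
    rw [PC_d]
    exact (ModuleCat.ofHom_comp (dP k L S e 0) (augP k L S e)).symm.trans
      (congrArg ModuleCat.ofHom aug_d)⟩

theorem PCπ_f_zero : (PCπ k L S e).f 0 = ModuleCat.ofHom (augP k L S e) :=
  ChainComplex.toSingle₀Equiv_symm_apply_f_zero _ _

theorem PC_quasiIso : QuasiIso (PCπ k L S e) where
  quasiIsoAt n := by
    cases n with
    | zero =>
      rw [ChainComplex.quasiIsoAt₀_iff, ShortComplex.quasiIso_iff_of_zeros' _ rfl rfl rfl]
      constructor
      · rw [ShortComplex.moduleCat_exact_iff]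
        intro x hx
        change (PCπ k L S e).f 0 x = 0 at hx
        change ∃ y, (PC k L S e).d 1 0 y = x
        rw [PCπ_f_zero] at hx
        rw [PC_d]
        exact aug_exact x hx
      · rw [ModuleCat.epi_iff_surjective]
        change Function.Surjective ((PCπ k L S e).f 0)
        rw [PCπ_f_zero]
        exact aug_surj (k := k) (L := L) (S := S) (e := e)
    | succ m =>
      rw [quasiIsoAt_iff_exactAt' (hL := ChainComplex.exactAt_succ_single_obj ..),
          HomologicalComplex.exactAt_iff' _ (m + 2) (m + 1) m (by simp) (by simp),
          ShortComplex.moduleCat_exact_iff]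
      intro x hx
      change (PC k L S e).d (m + 1) m x = 0 at hx
      change ∃ y, (PC k L S e).d (m + 2) (m + 1) y = x
      rw [PC_d] at hx ⊢
      exact dP_exact m x hx

variable {S e} in
/-- The bar resolution. -/
def PR (hidem : ∀ x : S, e x * e x = e x)
    (horth : ∀ x y : S, x ≠ y → e x * e y = 0)
    (hsum : ∑ x : S, e x = 1) : ProjectiveResolution (ModuleCat.of (L ⊗[k] Lᵐᵒᵖ) L) where
  complex := PC k L S e
  projective n := (IsProjective.iff_projective (R := L ⊗[k] Lᵐᵒᵖ) (PP k L S e n)).1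
    (PP_projective hidem horth hsum n)
  π := PCπ k L S e
  quasiIso := PC_quasiIso k L S e

end aux5
section aux6

set_option linter.unusedSectionVars false
set_option linter.unusedSimpArgs false

theorem coh_core (n : ℕ) (T : ShortComplex (ModuleCat.{0} k))
    (Φ : T.X₂ →ₗ[k] Raw L Z n) (_hinj : Function.Injective Φ)
    (hJ : ∀ f, IsJ k L Z S e f ↔ ∃ x, Φ x = f)
    (hg : ∀ x, T.g.hom x = 0 ↔ dLin k L Z n (Φ x) = 0)
    (hf : ∀ x, Φ x ∈ Bsub k L Z S e n ↔ ∃ y, T.f.hom y = x) :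
    Nonempty (Hcoh k L Z S e n ≃ₗ[k] T.homology) := by
  let Ψ : LinearMap.ker T.g.hom →ₗ[k] Zsub k L Z S e n :=
    (Φ.comp (LinearMap.ker T.g.hom).subtype).codRestrict _ (fun x =>
      ⟨(hJ _).2 ⟨x.1, rfl⟩, (hg x.1).1 x.2⟩)
  have hΨ : Function.Surjective Ψ := by
    rintro ⟨f, h1, h2⟩
    obtain ⟨x, rfl⟩ := (hJ f).1 h1
    exact ⟨⟨x, (hg x).2 h2⟩, rfl⟩
  let B := (Bsub k L Z S e n ⊓ Zsub k L Z S e n).comap (Zsub k L Z S e n).subtype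
  let q : LinearMap.ker T.g.hom →ₗ[k] (Zsub k L Z S e n ⧸ B) := B.mkQ.comp Ψ
  have hq : Function.Surjective q := B.mkQ_surjective.comp hΨ
  have hk : LinearMap.ker q = LinearMap.range T.moduleCatToCycles := by
    ext x
    rw [LinearMap.mem_ker]
    have h1 : q x = 0 ↔ Ψ x ∈ B := Submodule.Quotient.mk_eq_zero B
    have h2 : Ψ x ∈ B ↔ Φ x.1 ∈ Bsub k L Z S e n :=
      ⟨fun h => h.1, fun h => ⟨h, (Ψ x).2⟩⟩
    rw [h1, h2, hf]
    constructor
    · rintro ⟨y, hy⟩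
      exact ⟨y, Subtype.ext hy⟩
    · rintro ⟨y, hy⟩
      exact ⟨y, congrArg Subtype.val hy⟩
  let E1 : (LinearMap.ker T.g.hom ⧸ LinearMap.range T.moduleCatToCycles) ≃ₗ[k]
      (Zsub k L Z S e n ⧸ B) :=
    (Submodule.quotEquivOfEq _ _ hk.symm).trans (q.quotKerEquivOfSurjective hq)
  exact ⟨E1.symm.trans T.moduleCatHomologyIso.symm.toLinearEquiv⟩

/-- Evaluation on the universal cochain. -/
def evU (n : ℕ) : (ModuleCat.of (L ⊗[k] Lᵐᵒᵖ) (PP k L S e n) ⟶ ModuleCat.of (L ⊗[k] Lᵐᵒᵖ) Z)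
    →ₗ[k] Raw L Z n where
  toFun φ := fun v => φ.hom (uu k L S e n v)
  map_add' φ ψ := rfl
  map_smul' c φ := by
    funext v
    refine Eq.trans ?_ (env_smulk L c (φ.hom (uu k L S e n v))).symm
    have h : algebraMap k (L ⊗[k] Lᵐᵒᵖ) c = (c • (1 : L)) ⊗ₜ[k] (1 : Lᵐᵒᵖ) := by
      rw [Algebra.algebraMap_eq_smul_one, Algebra.TensorProduct.one_def,
        TensorProduct.smul_tmul']
    rw [← h]
    rfl

theorem evU_d (n : ℕ)
    (φ : ModuleCat.of (L ⊗[k] Lᵐᵒᵖ) (PP k L S e n) ⟶ ModuleCat.of (L ⊗[k] Lᵐᵒᵖ) Z) :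
    evU k L Z S e (n + 1) (ModuleCat.ofHom (dP k L S e n) ≫ φ)
      = dLin k L Z n (evU k L Z S e n φ) := by
  funext v
  exact hom_d φ.hom v

theorem evU_inj (n : ℕ) : Function.Injective (evU k L Z S e n) := fun φ ψ h => by
  ext1
  exact PP_hom_ext fun v => congrFun h v

theorem evU_J (n : ℕ) (f : Raw L Z n) : IsJ k L Z S e f ↔ ∃ x, evU k L Z S e n x = f := by
  constructor
  · intro hf
    exact ⟨ModuleCat.ofHom (PPdesc f hf), funext fun v => PPdesc_uu f hf v⟩
  · rintro ⟨φ, rfl⟩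
    exact hom_J φ.hom

theorem stmt_aux
    (hidem : ∀ x : S, e x * e x = e x)
    (horth : ∀ x y : S, x ≠ y → e x * e y = 0)
    (hsum : ∑ x : S, e x = 1) :
    ∀ n : ℕ, Nonempty (Hcoh k L Z S e n ≃ₗ[k] (HHZ k L Z n : Type)) := by
  intro n
  let K := (PC k L S e).linearYonedaObj k (ModuleCat.of (L ⊗[k] Lᵐᵒᵖ) Z)
  have I : HHZ k L Z n ≅ K.homology n :=
    (PR k L hidem horth hsum).isoExt (R := k) n (ModuleCat.of (L ⊗[k] Lᵐᵒᵖ) Z)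
  have hd : ∀ (m : ℕ) (x : K.X m), evU k L Z S e (m + 1) ((K.d m (m + 1)).hom x)
      = dLin k L Z m (evU k L Z S e m x) := by
    intro m x
    refine Eq.trans ?_ (evU_d k L Z S e m x)
    refine congrArg (evU k L Z S e (m + 1)) ?_
    rw [← PC_d]
    rfl
  have hg : ∀ (m : ℕ) (x : K.X m), (K.d m (m + 1)).hom x = 0 ↔
      dLin k L Z m (evU k L Z S e m x) = 0 := by
    intro m x
    constructor
    · intro h
      exact (hd m x).symm.trans
        ((congrArg (evU k L Z S e (m + 1)) h).trans (_root_.map_zero (evU k L Z S e (m + 1))))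
    · intro h
      exact evU_inj k L Z S e (m + 1)
        (((hd m x).trans h).trans (_root_.map_zero (evU k L Z S e (m + 1))).symm)
  have main : ∃ i, ∃ hi : (ComplexShape.up ℕ).prev n = i,
      Nonempty (Hcoh k L Z S e n ≃ₗ[k] (K.sc' i n (n + 1)).homology) := by
    cases n with
    | zero =>
      refine ⟨0, CochainComplex.prev_nat_zero, coh_core k L Z S e 0 (K.sc' 0 0 1)
        (evU k L Z S e 0) (evU_inj k L Z S e 0) (evU_J k L Z S e 0) (hg 0) ?_⟩
      intro x
      have h0 : (K.sc' 0 0 1).f = 0 := K.shape 0 0 (by simp)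
      rw [h0]
      change evU k L Z S e 0 x = 0 ↔ _
      constructor
      · intro h
        exact ⟨0, (evU_inj k L Z S e 0 (h.trans (_root_.map_zero (evU k L Z S e 0)).symm)).symm⟩
      · rintro ⟨y, rfl⟩
        exact _root_.map_zero (evU k L Z S e 0)
    | succ m =>
      refine ⟨m, CochainComplex.prev_nat_succ m, coh_core k L Z S e (m + 1)
        (K.sc' m (m + 1) (m + 2))
        (evU k L Z S e (m + 1)) (evU_inj k L Z S e (m + 1)) (evU_J k L Z S e (m + 1))
        (hg (m + 1)) ?_⟩
      intro x
      constructor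
      · rintro ⟨f, hf, hfx⟩
        obtain ⟨y, rfl⟩ := (evU_J k L Z S e m f).1 hf
        exact ⟨y, evU_inj k L Z S e (m + 1) ((hd m y).trans hfx)⟩
      · rintro ⟨y, rfl⟩
        exact ⟨evU k L Z S e m y, (evU_J k L Z S e m _).2 ⟨y, rfl⟩, (hd m y).symm⟩
  obtain ⟨i, hi, ⟨E1⟩⟩ := main
  exact ⟨E1.trans ((K.homologyIsoSc' i n (n + 1) hi (by simp)).symm ≪≫ I.symm).toLinearEquiv⟩

end aux6

/-- for a `k`-algebra `Λ` with a complete system `{e_x}_{x∈S}` of orthogonal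
idempotents spanning a (separable, commutative) subalgebra `D ≅ k^S`, and a
`Λ`-bimodule `Z`, the cohomology of the relative cochain complex `J•(Z)`, with
`J⁰ = Z^D`, `Jⁿ = Hom_{D-D}(Λ^{⊗_D n}, Z)` and the Hochschild coboundary, computes the
Hochschild cohomology: `Hⁿ(J•(Z)) ≅ HH^n(Λ, Z) = Ext^n_{Λ ⊗ Λᵒᵖ}(Λ, Z)` for all `n`. -/
theorem stmt_0
    (hidem : ∀ x : S, e x * e x = e x)
    (horth : ∀ x y : S, x ≠ y → e x * e y = 0)
    (hsum : ∑ x : S, e x = 1) :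
    ∀ n : ℕ, Nonempty (Hcoh k L Z S e n ≃ₗ[k] (HHZ k L Z n : Type)) := by
  exact stmt_aux k L Z S e hidem horth hsum

end

end
end

section
/- Let A and B be k-algebras and suppose the linear maps ᾱ : B →ₗ[k] A and β̄ : A →ₗ[k] B satisfy the associativity constraints for free rank-one corner bimodules. Then either ᾱ = 0 and β̄ = 0, or both A and B are spanned by their unit elements (every element of A is a scalar multiple of 1_A and every element of B is a scalar multiple of 1_B). Consequently, any square-algebra structure on [[A, A⊗B],[B⊗A, B]] whose corner bimodules are free of rank one is a null-square algebra, except when A = B = k. -/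
open scoped TensorProduct

theorem aux_fun {k V : Type} [Field k] [AddCommGroup V] [Module k V] (v : V) (hv : v ≠ 0) :
    ∃ f : V →ₗ[k] k, f v = 1 := by
  have hf' : ∃ g : V →ₗ[k] k, g v ≠ 0 := by
    by_contra! h
    exact hv ((Module.forall_dual_apply_eq_zero_iff k v).1 h)
  obtain ⟨g, hg⟩ := hf'
  exact ⟨(g v)⁻¹ • g, by simp [hg]⟩

theorem aux_tensor {k V W : Type} [Field k] [AddCommGroup V] [Module k V]
    [AddCommGroup W] [Module k W] (v y : V) (w x : W) (hv : v ≠ 0) (hw : w ≠ 0)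
    (h : v ⊗ₜ[k] x = y ⊗ₜ[k] w) : ∃ c : k, x = c • w ∧ y = c • v := by
  obtain ⟨f, hf⟩ := aux_fun (k := k) v hv
  obtain ⟨g, hg⟩ := aux_fun (k := k) w hw
  have e1 : x = f y • w := by
    simpa [hf] using congrArg (fun t => TensorProduct.lid k W (LinearMap.rTensor W f t)) h
  have e2 : g x • v = y := by
    simpa [hg] using congrArg (fun t => TensorProduct.rid k V (LinearMap.lTensor V g t)) h
  refine ⟨f y, e1, ?_⟩
  have e3 : g x = f y := by rw [e1]; simp [hg]
  rw [← e3, e2]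

/-- if the linear maps `ᾱ : B →ₗ[k] A` and `β̄ : A →ₗ[k] B` satisfy the
associativity constraints for free rank-one corner bimodules, then either both maps are zero
(the square algebra `[[A, A⊗B],[B⊗A, B]]` is a null-square algebra), or every element of `A`
is a scalar multiple of `1_A` and every element of `B` is a scalar multiple of `1_B`
(the exceptional case `A = B = k`). -/
theorem stmt_7 (k A B : Type) [Field k]
    [Ring A] [Algebra k A] [Ring B] [Algebra k B]
    (alpha : B →ₗ[k] A) (beta : A →ₗ[k] B)
    (h₁ : ∀ (a : A) (b : B),
      (1 : B) ⊗ₜ[k] (a * alpha b) = (beta a * b) ⊗ₜ[k] (1 : A))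
    (h₂ : ∀ (a : A) (b : B),
      (1 : A) ⊗ₜ[k] (b * beta a) = (alpha b * a) ⊗ₜ[k] (1 : B)) :
    (alpha = 0 ∧ beta = 0) ∨
      ((∀ a : A, ∃ c : k, a = c • (1 : A)) ∧ (∀ b : B, ∃ c : k, b = c • (1 : B))) := by
  rcases subsingleton_or_nontrivial A with hA | hA
  · left
    refine ⟨LinearMap.ext fun b => Subsingleton.elim _ _, LinearMap.ext fun a => ?_⟩
    rw [Subsingleton.elim a 0, map_zero, map_zero]
  rcases subsingleton_or_nontrivial B with hB | hB
  · left
    refine ⟨LinearMap.ext fun b => ?_, LinearMap.ext fun a => Subsingleton.elim _ _⟩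
    rw [Subsingleton.elim b 0, map_zero, map_zero]
  have key : ∀ (a : A) (b : B), ∃ c : k, a * alpha b = c • (1 : A) ∧ beta a * b = c • (1 : B) :=
    fun a b => aux_tensor _ _ _ _ one_ne_zero one_ne_zero (h₁ a b)
  obtain ⟨c, hc1, hc2⟩ := key 1 1
  rw [one_mul] at hc1
  rw [mul_one] at hc2
  by_cases hc : c = 0
  · left
    rw [hc, zero_smul] at hc1 hc2
    constructor
    · ext b
      obtain ⟨d, hd1, hd2⟩ := key 1 b
      rw [hc2, zero_mul] at hd2
      have : d = 0 := (smul_eq_zero.1 hd2.symm).resolve_right one_ne_zero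
      simpa [this] using hd1
    · ext a
      obtain ⟨d, hd1, hd2⟩ := key a 1
      rw [hc1, mul_zero] at hd1
      have : d = 0 := (smul_eq_zero.1 hd1.symm).resolve_right one_ne_zero
      simpa [this] using hd2
  · right
    constructor
    · intro a
      obtain ⟨d, hd1, -⟩ := key a 1
      rw [hc1, mul_smul_comm, mul_one] at hd1
      exact ⟨c⁻¹ * d, by rw [mul_smul, ← hd1, inv_smul_smul₀ hc]⟩
    · intro b
      obtain ⟨d, -, hd2⟩ := key 1 b
      rw [hc2, smul_mul_assoc, one_mul] at hd2
      exact ⟨c⁻¹ * d, by rw [mul_smul, ← hd2, inv_smul_smul₀ hc]⟩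
end

section
/- Let A and B be nontrivial k-algebras (1_A ≠ 0 and 1_B ≠ 0) and let ᾱ : B →ₗ[k] A and β̄ : A →ₗ[k] B be linear maps satisfying the first associativity constraint: (1_B) ⊗ (a·ᾱ(b)) = (β̄(a)·b) ⊗ (1_A) in B ⊗[k] A for all a ∈ A and b ∈ B. Then there exists λ ∈ k such that ᾱ(1_B) = λ·1_A and β̄(1_A) = λ·1_B. -/
open scoped TensorProduct

/-- if `A` and `B` are nontrivial `k`-algebras and the linear maps
`ᾱ : B →ₗ[k] A`, `β̄ : A →ₗ[k] B` satisfy the first associativity constraint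
`1_B ⊗ (a·ᾱ(b)) = (β̄(a)·b) ⊗ 1_A` in `B ⊗[k] A`, then there is a scalar `λ` with
`ᾱ(1_B) = λ·1_A` and `β̄(1_A) = λ·1_B`. -/
theorem stmt_8 (k A B : Type) [Field k]
    [Ring A] [Algebra k A] [Ring B] [Algebra k B]
    (hA : (1 : A) ≠ 0) (hB : (1 : B) ≠ 0)
    (alpha : B →ₗ[k] A) (beta : A →ₗ[k] B)
    (h : ∀ (a : A) (b : B),
      (1 : B) ⊗ₜ[k] (a * alpha b) = (beta a * b) ⊗ₜ[k] (1 : A)) :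
    ∃ lam : k, alpha 1 = lam • (1 : A) ∧ beta 1 = lam • (1 : B) := by
  have key : ∀ (V : Type) [AddCommGroup V] [Module k V] (v : V), v ≠ 0 →
      ∃ f : V →ₗ[k] k, f v = 1 := by
    intro V _ _ v hv
    obtain ⟨f, hf⟩ := LinearMap.exists_leftInverse_of_injective
      (LinearMap.toSpanSingleton k V v) (LinearMap.ker_toSpanSingleton k hv)
    refine ⟨f, ?_⟩
    have := LinearMap.congr_fun hf 1
    simpa using this
  obtain ⟨f, hf⟩ := key B 1 hB
  obtain ⟨g, hg⟩ := key A 1 hA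
  have h1 := h 1 1
  rw [one_mul, mul_one] at h1
  have e1 : alpha 1 = f (beta 1) • (1 : A) := by
    have := congrArg (fun t => TensorProduct.lid k A (LinearMap.rTensor A f t)) h1
    simpa [hf] using this
  have e2 : g (alpha 1) • (1 : B) = beta 1 := by
    have := congrArg (fun t => TensorProduct.rid k B (LinearMap.lTensor B g t)) h1
    simpa [hg] using this
  have e3 : g (alpha 1) = f (beta 1) := by
    rw [e1, map_smul, hg, smul_eq_mul, mul_one]
  exact ⟨f (beta 1), e1, by rw [← e3, e2]⟩
end
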